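/- arXiv:2006.04210 — 5 statements merged into one kernel-verified Lean document; each statement's English description precedes it below -/
import Mathlib

section
/- Let U ⊆ ℝ² be an open set, let v : U → ℝ^L be twice continuously differentiable, and let X = (X₁, X₂) : U → ℝ² be continuously differentiable. Writing X·∇v = X₁ ∂₁v + X₂ ∂₂v, the pointwise Pohozaev identity holds at every point of U: ⟨X·∇v, Δv⟩ = ∂₁(⟨X·∇v, ∂₁v⟩ − ½|∇v|² X₁) + ∂₂(⟨X·∇v, ∂₂v⟩ − ½|∇v|² X₂) + ½|∇v|² (∂₁X₁ + ∂₂X₂) − Σ_{i,j=1}^{2} (∂_j X_i) ⟨∂_i v, ∂_j v⟩. -/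
open RealInnerProductSpace

/-- First partial derivative (in the direction `(1,0)`) of a map on `ℝ × ℝ`. -/
noncomputable def pd1 {E : Type*} [NormedAddCommGroup E] [NormedSpace ℝ E]
    (f : ℝ × ℝ → E) (x : ℝ × ℝ) : E := fderiv ℝ f x (1, 0)

/-- Second partial derivative (in the direction `(0,1)`) of a map on `ℝ × ℝ`. -/
noncomputable def pd2 {E : Type*} [NormedAddCommGroup E] [NormedSpace ℝ E]
    (f : ℝ × ℝ → E) (x : ℝ × ℝ) : E := fderiv ℝ f x (0, 1)

/-- A directional derivative of a `C²` map is differentiable. -/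
lemma differentiableAt_fderiv_apply {F E : Type*} [NormedAddCommGroup F] [NormedSpace ℝ F]
    [NormedAddCommGroup E] [NormedSpace ℝ E] {f : F → E} {x : F} (hf : ContDiffAt ℝ 2 f x)
    (e : F) : DifferentiableAt ℝ (fun y => fderiv ℝ f y e) x :=
  ((hf.fderiv_right (m := 1) (by norm_num)).differentiableAt one_ne_zero).clm_apply
    (differentiableAt_const e)

/-- Mixed directional derivatives of a `C²` map commute. -/
lemma fderiv_fderiv_apply_comm {F E : Type*} [NormedAddCommGroup F] [NormedSpace ℝ F]
    [NormedAddCommGroup E] [NormedSpace ℝ E] {f : F → E} {x : F} (hf : ContDiffAt ℝ 2 f x)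
    (e e' : F) :
    fderiv ℝ (fun y => fderiv ℝ f y e) x e' = fderiv ℝ (fun y => fderiv ℝ f y e') x e := by
  have hd : DifferentiableAt ℝ (fderiv ℝ f) x :=
    (hf.fderiv_right (m := 1) (by norm_num)).differentiableAt one_ne_zero
  have hs : IsSymmSndFDerivAt ℝ f x := hf.isSymmSndFDerivAt (by simp)
  rw [fderiv_clm_apply hd (differentiableAt_const e),
    fderiv_clm_apply hd (differentiableAt_const e')]
  simpa using hs e' e

/-- Product rule for `⟪a v₁ + b v₂, w⟫ - ½ (|v₁|² + |v₂|²) c` in the direction `e`. -/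
lemma fderiv_inner_sub_energy_apply {F E : Type*} [NormedAddCommGroup F] [NormedSpace ℝ F]
    [NormedAddCommGroup E] [InnerProductSpace ℝ E] {a b c : F → ℝ} {v₁ v₂ w : F → E} {x : F}
    (ha : DifferentiableAt ℝ a x) (hb : DifferentiableAt ℝ b x) (hc : DifferentiableAt ℝ c x)
    (h₁ : DifferentiableAt ℝ v₁ x) (h₂ : DifferentiableAt ℝ v₂ x)
    (hw : DifferentiableAt ℝ w x) (e : F) :
    fderiv ℝ (fun y => ⟪a y • v₁ y + b y • v₂ y, w y⟫
        - 1 / 2 * (‖v₁ y‖ ^ 2 + ‖v₂ y‖ ^ 2) * c y) x e =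
      ⟪a x • v₁ x + b x • v₂ x, fderiv ℝ w x e⟫
      + ⟪a x • fderiv ℝ v₁ x e + fderiv ℝ a x e • v₁ x
          + (b x • fderiv ℝ v₂ x e + fderiv ℝ b x e • v₂ x), w x⟫
      - ((⟪v₁ x, fderiv ℝ v₁ x e⟫ + ⟪v₂ x, fderiv ℝ v₂ x e⟫) * c x
        + 1 / 2 * (‖v₁ x‖ ^ 2 + ‖v₂ x‖ ^ 2) * fderiv ℝ c x e) := by
  have h := (((ha.hasFDerivAt.smul h₁.hasFDerivAt).add (hb.hasFDerivAt.smul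
    h₂.hasFDerivAt)).inner ℝ hw.hasFDerivAt).sub
    (((h₁.hasFDerivAt.norm_sq.add h₂.hasFDerivAt.norm_sq).const_mul (1 / 2 : ℝ)).mul
      hc.hasFDerivAt)
  refine (congrArg (fun T : F →L[ℝ] ℝ => T e) h.fderiv).trans ?_
  simp
  ring

/-- Pointwise Pohozaev identity: for `v : U → ℝ^L` of class `C²` and a `C¹` vector field
`X = (X₁, X₂)`, at every point of the open set `U`,
`⟨X·∇v, Δv⟩ = ∂₁(⟨X·∇v, ∂₁v⟩ − ½|∇v|² X₁) + ∂₂(⟨X·∇v, ∂₂v⟩ − ½|∇v|² X₂)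
  + ½|∇v|² div X − Σ_{i,j} (∂_j X_i) ⟨∂_i v, ∂_j v⟩`. -/
theorem pohozaev_pointwise {L : ℕ} (U : Set (ℝ × ℝ)) (hU : IsOpen U)
    (v : ℝ × ℝ → EuclideanSpace ℝ (Fin L)) (hv : ContDiffOn ℝ 2 v U)
    (X : ℝ × ℝ → ℝ × ℝ) (hX : ContDiffOn ℝ 1 X U)
    (p : ℝ × ℝ) (hp : p ∈ U) :
    ⟪(X p).1 • pd1 v p + (X p).2 • pd2 v p, pd1 (pd1 v) p + pd2 (pd2 v) p⟫ =
      pd1 (fun x => ⟪(X x).1 • pd1 v x + (X x).2 • pd2 v x, pd1 v x⟫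
          - 1 / 2 * (‖pd1 v x‖ ^ 2 + ‖pd2 v x‖ ^ 2) * (X x).1) p
      + pd2 (fun x => ⟪(X x).1 • pd1 v x + (X x).2 • pd2 v x, pd2 v x⟫
          - 1 / 2 * (‖pd1 v x‖ ^ 2 + ‖pd2 v x‖ ^ 2) * (X x).2) p
      + 1 / 2 * (‖pd1 v p‖ ^ 2 + ‖pd2 v p‖ ^ 2)
          * (pd1 (fun x => (X x).1) p + pd2 (fun x => (X x).2) p)
      - (pd1 (fun x => (X x).1) p * ⟪pd1 v p, pd1 v p⟫
        + pd2 (fun x => (X x).1) p * ⟪pd1 v p, pd2 v p⟫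
        + pd1 (fun x => (X x).2) p * ⟪pd2 v p, pd1 v p⟫
        + pd2 (fun x => (X x).2) p * ⟪pd2 v p, pd2 v p⟫) := by
  have hv' : ContDiffAt ℝ 2 v p := hv.contDiffAt (hU.mem_nhds hp)
  have hX' : DifferentiableAt ℝ X p :=
    (hX.contDiffAt (hU.mem_nhds hp)).differentiableAt one_ne_zero
  have h₁ : DifferentiableAt ℝ (pd1 v) p := differentiableAt_fderiv_apply hv' _
  have h₂ : DifferentiableAt ℝ (pd2 v) p := differentiableAt_fderiv_apply hv' _
  have hcomm : fderiv ℝ (pd1 v) p (0, 1) = fderiv ℝ (pd2 v) p (1, 0) :=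
    fderiv_fderiv_apply_comm hv' _ _
  rw [pd1.eq_def (fun x => ⟪_, _⟫ - _), pd2.eq_def (fun x => ⟪_, _⟫ - _),
    fderiv_inner_sub_energy_apply hX'.fst hX'.snd hX'.fst h₁ h₂ h₁,
    fderiv_inner_sub_energy_apply hX'.fst hX'.snd hX'.snd h₁ h₂ h₂, hcomm,
    pd1.eq_def (pd1 v), pd2.eq_def (pd2 v), pd1.eq_def (fun x => (X x).1),
    pd1.eq_def (fun x => (X x).2), pd2.eq_def (fun x => (X x).1), pd2.eq_def (fun x => (X x).2)]
  simp only [inner_add_left, inner_add_right, real_inner_smul_left]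
  rw [real_inner_comm (pd1 v p) (fderiv ℝ (pd1 v) p (1, 0)),
    real_inner_comm (pd1 v p) (fderiv ℝ (pd2 v) p (1, 0)),
    real_inner_comm (pd2 v p) (fderiv ℝ (pd2 v) p (1, 0)),
    real_inner_comm (pd2 v p) (fderiv ℝ (pd2 v) p (0, 1))]
  ring
end

section
/- Let (f_k)_{k∈ℕ} be a sequence of nonnegative measurable functions on ℝ², and let Λ > 0, δ > 0 be constants such that ∫_{ℝ²} f_k dx ≤ Λ for every k. Define the concentration set Σ = { x ∈ ℝ² : for every r > 0, liminf_{k→∞} ∫_{B_r(x)} f_k dx > δ² }. Then Σ is a finite set and its cardinality is at most Λ/δ². -/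
open MeasureTheory Filter

/-- If each point of a finite set `s` has liminf mass more than `c` in every ball around it, along
a sequence of measures of total mass at most `M`, then `#s * c ≤ M`. -/
theorem card_mul_le_of_lt_liminf_measure_ball {X : Type*} [MetricSpace X] [MeasurableSpace X]
    [OpensMeasurableSpace X] {μ : ℕ → Measure X} {c M : ENNReal}
    (hM : ∀ k, μ k Set.univ ≤ M) (s : Finset X)
    (hs : ∀ x ∈ s, ∀ r > 0, c < liminf (fun k => μ k (Metric.ball x r)) atTop) :
    s.card * c ≤ M := by
  obtain ⟨U, hU, hdisj⟩ := s.finite_toSet.t2_separation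
  choose r hr hrU using fun x => Metric.isOpen_iff.1 (hU x).2 x (hU x).1
  have hev : ∀ᶠ k in atTop, ∀ x ∈ s, c < μ k (Metric.ball x (r x)) :=
    s.eventually_all.2 fun x hx => eventually_lt_of_lt_liminf (hs x hx (r x) (hr x))
  obtain ⟨k, hk⟩ := hev.exists
  calc s.card * c = ∑ x ∈ s, c := by simp
    _ ≤ ∑ x ∈ s, μ k (Metric.ball x (r x)) := Finset.sum_le_sum fun x hx => (hk x hx).le
    _ = μ k (⋃ x ∈ s, Metric.ball x (r x)) :=
        (measure_biUnion_finset (hdisj.mono fun x => hrU x)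
          fun x _ => Metric.isOpen_ball.measurableSet).symm
    _ ≤ M := (measure_mono (Set.subset_univ _)).trans (hM k)

/-- If `(f_k)` is a sequence of nonnegative measurable functions on `ℝ²` with
`∫ f_k ≤ Λ` for all `k`, then the concentration set
`Σ = { x : ∀ r > 0, liminf_k ∫_{B_r(x)} f_k > δ² }` is finite with cardinality at most
`Λ/δ²`. -/
theorem concentration_set_finite (f : ℕ → EuclideanSpace ℝ (Fin 2) → ℝ) (Λ δ : ℝ)
    (hΛ : 0 < Λ) (hδ : 0 < δ)
    (hmeas : ∀ k, Measurable (f k)) (hnonneg : ∀ k x, 0 ≤ f k x)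
    (hbound : ∀ k, ∫⁻ x, ENNReal.ofReal (f k x) ≤ ENNReal.ofReal Λ) :
    {x : EuclideanSpace ℝ (Fin 2) | ∀ r > 0, ENNReal.ofReal (δ ^ 2) <
        liminf (fun k => ∫⁻ y in Metric.ball x r, ENNReal.ofReal (f k y)) atTop}.Finite ∧
    (({x : EuclideanSpace ℝ (Fin 2) | ∀ r > 0, ENNReal.ofReal (δ ^ 2) <
        liminf (fun k => ∫⁻ y in Metric.ball x r, ENNReal.ofReal (f k y)) atTop}).ncard : ℝ)
      ≤ Λ / δ ^ 2 := by
  set S := {x : EuclideanSpace ℝ (Fin 2) | ∀ r > 0, ENNReal.ofReal (δ ^ 2) <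
        liminf (fun k => ∫⁻ y in Metric.ball x r, ENNReal.ofReal (f k y)) atTop}
  have hδ2 : 0 < δ ^ 2 := by positivity
  have key : ∀ s : Finset (EuclideanSpace ℝ (Fin 2)), ↑s ⊆ S → (s.card : ℝ) ≤ Λ / δ ^ 2 := by
    intro s hs
    have h := card_mul_le_of_lt_liminf_measure_ball
      (μ := fun k => volume.withDensity fun x => ENNReal.ofReal (f k x))
      (c := ENNReal.ofReal (δ ^ 2)) (M := ENNReal.ofReal Λ)
      (fun k => by simpa using hbound k) s
      (fun x hx r hr => by
        simpa only [withDensity_apply _ Metric.isOpen_ball.measurableSet] using hs hx r hr)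
    rw [← ENNReal.ofReal_natCast, ← ENNReal.ofReal_mul (Nat.cast_nonneg _),
      ENNReal.ofReal_le_ofReal_iff hΛ.le] at h
    exact (le_div_iff₀ hδ2).2 h
  have hfin : S.Finite := by
    by_contra hinf
    obtain ⟨n, hn⟩ := exists_nat_gt (Λ / δ ^ 2)
    obtain ⟨t, htS, rfl⟩ := Set.Infinite.exists_subset_card_eq hinf n
    exact (key t htS).not_gt hn
  refine ⟨hfin, ?_⟩
  rw [Set.ncard_eq_toFinset_card S hfin]
  exact key hfin.toFinset (by simp)
end

section
/- (Cauchy–Pompeiu formula) Let R > 0, c ∈ ℂ, and let f : ℂ → ℂ be continuously differentiable (as a map ℝ² → ℝ²) on an open neighborhood of the closed disc D̄_R(c). Define ∂̄f = ½(∂_x f + i ∂_y f). Then for every z in the open disc D_R(c), f(z) = (1/(2πi)) ∮_{|w−c|=R} f(w)/(w − z) dw − (1/π) ∫_{D_R(c)} (∂̄f)(w)/(w − z) dA(w), where the first integral is the counterclockwise contour integral over the circle of radius R centered at c, and dA denotes Lebesgue measure on ℂ ≅ ℝ². -/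
open MeasureTheory

section

open Metric Set

/-- The map `w ↦ z + ‖w‖ a + R w`. For `a = c - z` with `‖a‖ < R` it carries the unit disc to the
disc of radius `R` centred at `c`, sending each radius of the unit disc linearly onto a segment issued from `z`. -/
noncomputable def starMap (z a : ℂ) (R : ℝ) (w : ℂ) : ℂ := z + (‖w‖ • a + R • w)

theorem starMap_injective {z a : ℂ} {R : ℝ} (ha : ‖a‖ < R) : Function.Injective (starMap z a R) := by
  intro v w h
  have hR : 0 < R := (norm_nonneg a).trans_lt ha
  have h1 : R • (v - w) = (‖w‖ - ‖v‖) • a := by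
    simp only [starMap, add_right_inj] at h
    simp only [smul_sub, sub_smul]
    linear_combination h
  have h2 : R * ‖v - w‖ = |‖w‖ - ‖v‖| * ‖a‖ := by
    simpa only [norm_smul, Real.norm_eq_abs, abs_of_pos hR] using congrArg norm h1
  have h3 : |‖w‖ - ‖v‖| ≤ ‖v - w‖ := by
    rw [norm_sub_rev]
    exact abs_norm_sub_norm_le w v
  have h4 : |‖w‖ - ‖v‖| * ‖a‖ ≤ ‖v - w‖ * ‖a‖ := by gcongr
  by_contra hne
  have : 0 < ‖v - w‖ := norm_pos_iff.2 (sub_ne_zero.2 hne)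
  nlinarith

theorem image_starMap {z c : ℂ} {R : ℝ} (hz : z ∈ ball c R) :
    starMap z (c - z) R '' (ball 0 1 \ {0}) = ball c R \ {z} := by
  have ha : ‖c - z‖ < R := by rwa [mem_ball, dist_comm, dist_eq_norm] at hz
  have hR : 0 < R := (norm_nonneg _).trans_lt ha
  ext w
  constructor
  · rintro ⟨v, ⟨hv, hv0⟩, rfl⟩
    rw [mem_ball_zero_iff] at hv
    refine ⟨?_, fun h => hv0 ?_⟩
    · have : starMap z (c - z) R v - c = (‖v‖ - 1) • (c - z) + R • v := by
        simp only [starMap, sub_smul, one_smul]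
        ring
      rw [mem_ball, dist_eq_norm, this]
      refine (norm_add_le _ _).trans_lt ?_
      rw [norm_smul, norm_smul, Real.norm_eq_abs, Real.norm_eq_abs, abs_of_pos hR,
        abs_of_neg (by linarith)]
      nlinarith
    · exact starMap_injective (z := z) ha (by simpa [starMap] using h)
  · rintro ⟨hw, hwz⟩
    let h : ℝ → ℝ := fun t => R * t - ‖w - z - t • (c - z)‖
    have hcont : ContinuousOn h (Icc 0 1) := by fun_prop
    have h0 : h 0 ≤ 0 := by simp [h]
    have h1 : 0 < h 1 := by simpa [h, dist_eq_norm] using hw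
    obtain ⟨t, ⟨ht0, ht1⟩, ht⟩ := intermediate_value_Icc zero_le_one hcont ⟨h0, h1.le⟩
    have htR : ‖w - z - t • (c - z)‖ = R * t := by
      simp only [h] at ht
      linarith
    have hnorm : ‖R⁻¹ • (w - z - t • (c - z))‖ = t := by
      rw [norm_smul, htR, norm_inv, Real.norm_eq_abs, abs_of_pos hR]
      field_simp
    refine ⟨R⁻¹ • (w - z - t • (c - z)), ⟨?_, fun h' => hwz ?_⟩, ?_⟩
    · rw [mem_ball_zero_iff, hnorm]
      refine lt_of_le_of_ne ht1 ?_
      rintro rfl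
      exact h1.ne' ht
    · have ht' : t = 0 := by rw [← hnorm, h', norm_zero]
      rw [ht', mul_zero, zero_smul, sub_zero, norm_eq_zero] at htR
      exact sub_eq_zero.1 htR
    · rw [starMap, hnorm, smul_smul, mul_inv_cancel₀ hR.ne', one_smul]
      ring

theorem hasFDerivAt_starMap (z a : ℂ) (R : ℝ) {w : ℂ} (hw : w ≠ 0) :
    HasFDerivAt (starMap z a R)
      ((‖w‖⁻¹ • innerSL ℝ w).smulRight a + R • ContinuousLinearMap.id ℝ ℂ) w := by
  have hn : HasFDerivAt (fun v : ℂ => ‖v‖) (‖w‖⁻¹ • innerSL ℝ w) w := by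
    have h := (hasStrictFDerivAt_norm_sq w).hasFDerivAt.sqrt (by simpa using hw)
    simp only [Real.sqrt_sq (norm_nonneg _)] at h
    have hcoef : (1 / (2 * ‖w‖)) * ((2 : ℕ) : ℝ) = ‖w‖⁻¹ := by
      push_cast
      field_simp
    rwa [← Nat.cast_smul_eq_nsmul ℝ, smul_smul, hcoef] at h
  exact ((hn.smul_const a).add ((hasFDerivAt_id w).const_smul R)).const_add z

theorem det_fderiv_starMap (a : ℂ) (R : ℝ) (w : ℂ) :
    ((‖w‖⁻¹ • innerSL ℝ w).smulRight a + R • ContinuousLinearMap.id ℝ ℂ).det =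
      R ^ 2 + R * (‖w‖⁻¹ * (w.re * a.re + w.im * a.im)) := by
  rw [ContinuousLinearMap.det, ← LinearMap.det_toMatrix Complex.basisOneI, Matrix.det_fin_two]
  simp [LinearMap.toMatrix_apply, Complex.basisOneI]
  ring

/-- The signed area of the parallelogram spanned by the vector from `z` to the point of parameter
`θ` of a circle and by the velocity of the circle there. -/
noncomputable def starDensity (z c : ℂ) (R θ : ℝ) : ℝ :=
  (circleMap c R θ - z).re * (circleMap 0 R θ * Complex.I).im -
    (circleMap c R θ - z).im * (circleMap 0 R θ * Complex.I).re

theorem starDensity_pos {z c : ℂ} {R : ℝ} (hz : z ∈ ball c R) (θ : ℝ) :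
    0 < starDensity z c R θ := by
  have ha : ‖c - z‖ < R := by rwa [mem_ball, dist_comm, dist_eq_norm] at hz
  have hR : 0 < R := (norm_nonneg _).trans_lt ha
  have hdens : starDensity z c R θ =
      R * (R + ((c - z) * Complex.exp (((-θ : ℝ) : ℂ) * Complex.I)).re) := by
    rw [Complex.mul_re, Complex.exp_ofReal_mul_I_re, Complex.exp_ofReal_mul_I_im]
    simp [starDensity, circleMap, Complex.exp_ofReal_mul_I_re, Complex.exp_ofReal_mul_I_im]
    linear_combination R ^ 2 * Real.sin_sq_add_cos_sq θ
  have h := Complex.abs_re_le_norm ((c - z) * Complex.exp (((-θ : ℝ) : ℂ) * Complex.I))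
  rw [norm_mul, Complex.norm_exp_ofReal_mul_I, mul_one] at h
  rw [hdens]
  exact mul_pos hR (by linarith [(abs_le.1 h).1])

/-- Integration over a disc in polar-type coordinates centred at an arbitrary point `z` of it. -/
theorem setIntegral_ball_eq_setIntegral_star {z c : ℂ} {R : ℝ} (hz : z ∈ ball c R) (g : ℂ → ℂ) :
    ∫ w in ball c R, g w = ∫ p in Ioo (0 : ℝ) 1 ×ˢ Ioo (-Real.pi) Real.pi,
      (p.1 * starDensity z c R p.2) • g (z + p.1 * (circleMap c R p.2 - z)) := by
  have ha : ‖c - z‖ < R := by rwa [mem_ball, dist_comm, dist_eq_norm] at hz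
  have hR : 0 < R := (norm_nonneg _).trans_lt ha
  have hdiff (s : Set ℂ) (x : ℂ) : (s \ {x} : Set ℂ) =ᵐ[volume] s :=
    sdiff_null_ae_eq_self (measure_singleton x)
  rw [← setIntegral_congr_set (hdiff _ z), ← image_starMap hz,
    integral_image_eq_integral_abs_det_fderiv_smul volume
      (measurableSet_ball.diff (measurableSet_singleton _))
      (fun w hw => (hasFDerivAt_starMap z (c - z) R hw.2).hasFDerivWithinAt)
      (starMap_injective ha).injOn, setIntegral_congr_set (hdiff _ 0),
    ← integral_indicator measurableSet_ball, ← Complex.integral_comp_polarCoord_symm,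
    ← integral_indicator polarCoord.open_target.measurableSet,
    ← integral_indicator (measurableSet_Ioo.prod measurableSet_Ioo)]
  congr 1
  ext1 ⟨r, θ⟩
  have hmem : (r, θ) ∈ Ioo (0 : ℝ) 1 ×ˢ Ioo (-Real.pi) Real.pi ↔
      (r, θ) ∈ polarCoord.target ∧ r < 1 := by
    simp [polarCoord_target]
    tauto
  by_cases hp : (r, θ) ∈ polarCoord.target
  swap
  · rw [indicator_of_notMem hp, indicator_of_notMem (fun h => hp (hmem.1 h).1)]
  have hr : 0 < r := by
    rw [polarCoord_target] at hp
    exact hp.1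
  have hv : Complex.polarCoord.symm (r, θ) = r * Complex.exp (θ * Complex.I) := by
    rw [Complex.polarCoord_symm_apply, Complex.exp_mul_I, Complex.ofReal_cos, Complex.ofReal_sin]
  have hvn : ‖(r : ℂ) * Complex.exp (θ * Complex.I)‖ = r := by
    rw [norm_mul, Complex.norm_exp_ofReal_mul_I, mul_one, Complex.norm_of_nonneg hr.le]
  rw [indicator_of_mem hp]
  dsimp only
  rw [hv]
  by_cases hr1 : r < 1
  swap
  · rw [indicator_of_notMem (fun h => hr1 (hmem.1 h).2),
      indicator_of_notMem (by rwa [mem_ball_zero_iff, hvn]), smul_zero]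
  rw [indicator_of_mem (hmem.2 ⟨hp, hr1⟩), indicator_of_mem (by rwa [mem_ball_zero_iff, hvn]),
    smul_smul, det_fderiv_starMap, hvn]
  have hpt : starMap z (c - z) R (r * Complex.exp (θ * Complex.I)) =
      z + r * (circleMap c R θ - z) := by
    rw [starMap, hvn, circleMap, Complex.real_smul, Complex.real_smul]
    ring
  have hdens : R ^ 2 + R * (r⁻¹ * ((r * Complex.exp (θ * Complex.I)).re * (c - z).re +
      (r * Complex.exp (θ * Complex.I)).im * (c - z).im)) = starDensity z c R θ := by
    simp [starDensity, circleMap, Complex.exp_ofReal_mul_I_re, Complex.exp_ofReal_mul_I_im]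
    field_simp
    linear_combination -R * Real.sin_sq_add_cos_sq θ
  rw [hpt, hdens, abs_of_pos (starDensity_pos hz θ)]

theorem segment_mem_ball {z c : ℂ} {R : ℝ} (hz : z ∈ ball c R) {r : ℝ} (hr : r ∈ Icc (0 : ℝ) 1)
    (θ : ℝ) : z + r * (circleMap c R θ - z) ∈ closedBall c R := by
  have hR : 0 ≤ R := (pos_of_mem_ball hz).le
  have := (convex_closedBall c R).add_smul_sub_mem (ball_subset_closedBall hz)
    (circleMap_mem_closedBall c hR θ) hr
  simpa using this

theorem circleMap_sub_ne_zero {z c : ℂ} {R : ℝ} (hz : z ∈ ball c R) (θ : ℝ) :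
    circleMap c R θ - z ≠ 0 :=
  sub_ne_zero.2 (circleMap_ne_mem_ball hz θ)

/-- The coordinate form, along the segments issued from `z`, of the identity
`d (f dw / (w - z)) = 2i ∂̄f / (w - z) dA`. -/
theorem dbar_mul_starDensity (T : ℂ →L[ℝ] ℂ) {z c : ℂ} {R : ℝ} (hz : z ∈ ball c R) {r : ℝ}
    (hr : r ≠ 0) (θ : ℝ) :
    2 * Complex.I * ((r * starDensity z c R θ) • (((1 / 2) * (T 1 + Complex.I * T Complex.I)) /
        (z + r * (circleMap c R θ - z) - z))) =
      T (circleMap c R θ - z) * (circleMap 0 R θ * Complex.I / (circleMap c R θ - z)) -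
        T (circleMap 0 R θ * Complex.I) := by
  have hγ := circleMap_sub_ne_zero hz θ
  have hr' : (r : ℂ) ≠ 0 := Complex.ofReal_ne_zero.2 hr
  have hT (w : ℂ) : T w = w.re * T 1 + w.im * T Complex.I := by
    conv_lhs => rw [← Complex.re_add_im w]
    have hre : (w.re : ℂ) = w.re • (1 : ℂ) := by simp
    rw [map_add, hre, ← Complex.real_smul, map_smul, map_smul, Complex.real_smul,
      Complex.real_smul, ← hre]
  rw [hT (circleMap c R θ - z), hT (circleMap 0 R θ * Complex.I), starDensity]
  generalize circleMap c R θ - z = u at *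
  generalize circleMap 0 R θ * Complex.I = v at *
  rw [add_sub_cancel_left, Complex.real_smul]
  field_simp
  push_cast
  linear_combination -(r * (v.im * T Complex.I + v.re * T 1)) * Complex.re_add_im u +
    r * (u.re * T 1 + u.im * T Complex.I) * Complex.re_add_im v +
    r * T Complex.I * (u.re * v.im - u.im * v.re) * Complex.I_sq

theorem continuousOn_fderiv_segment {z c : ℂ} {R : ℝ} {f : ℂ → ℂ} {U : Set ℂ} (hU : IsOpen U)
    (hUc : closedBall c R ⊆ U) (hf : ContDiffOn ℝ 1 f U) (hz : z ∈ ball c R) :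
    ContinuousOn (fun p : ℝ × ℝ => fderiv ℝ f (z + p.1 * (circleMap c R p.2 - z)))
      (Icc 0 1 ×ˢ univ) := by
  refine (hf.continuousOn_fderiv_of_isOpen hU le_rfl).comp (Continuous.continuousOn ?_)
    fun p hp => hUc (segment_mem_ball hz hp.1 p.2)
  have := continuous_circleMap c R
  fun_prop

theorem integral_fderiv_tangential {z c : ℂ} {R : ℝ} {f : ℂ → ℂ} {U : Set ℂ} (hU : IsOpen U)
    (hUc : closedBall c R ⊆ U) (hf : ContDiffOn ℝ 1 f U) (hz : z ∈ ball c R) {r : ℝ}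
    (hr : r ∈ Ioc (0 : ℝ) 1) :
    ∫ θ in -Real.pi..Real.pi, fderiv ℝ f (z + r * (circleMap c R θ - z))
      (circleMap 0 R θ * Complex.I) = 0 := by
  have hr' : r ∈ Icc (0 : ℝ) 1 := Ioc_subset_Icc_self hr
  have hderiv (θ : ℝ) : HasDerivAt (fun θ : ℝ => r⁻¹ • f (z + r * (circleMap c R θ - z)))
      (fderiv ℝ f (z + r * (circleMap c R θ - z)) (circleMap 0 R θ * Complex.I)) θ := by
    have h1 := ((hf.differentiableOn one_ne_zero).differentiableAt
      (hU.mem_nhds (hUc (segment_mem_ball hz hr' θ)))).hasFDerivAt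
    have h2 : HasDerivAt (fun θ : ℝ => z + r * (circleMap c R θ - z))
        (r • (circleMap 0 R θ * Complex.I)) θ := by
      simpa using (((hasDerivAt_circleMap c R θ).sub_const z).const_mul (r : ℂ)).const_add z
    have h3 := (h1.comp_hasDerivAt θ h2).const_smul r⁻¹
    rwa [map_smul, smul_smul, inv_mul_cancel₀ hr.1.ne', one_smul] at h3
  rw [intervalIntegral.integral_eq_sub_of_hasDerivAt (fun θ _ => hderiv θ)]
  · have hper := periodic_circleMap c R (-Real.pi)
    rw [show -Real.pi + 2 * Real.pi = Real.pi by ring] at hper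
    rw [hper, sub_self]
  · refine Continuous.intervalIntegrable ?_ _ _
    have h := (continuousOn_fderiv_segment hU hUc hf hz).comp_continuous
      (f := fun θ : ℝ => (r, θ)) (by fun_prop) (fun θ => ⟨hr', mem_univ _⟩)
    exact h.clm_apply ((continuous_circleMap 0 R).mul_const _)

theorem integral_fderiv_radial {z c : ℂ} {R : ℝ} {f : ℂ → ℂ} {U : Set ℂ} (hU : IsOpen U)
    (hUc : closedBall c R ⊆ U) (hf : ContDiffOn ℝ 1 f U) (hz : z ∈ ball c R) (θ : ℝ) :
    ∫ r in (0 : ℝ)..1, fderiv ℝ f (z + r * (circleMap c R θ - z)) (circleMap c R θ - z) =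
      f (circleMap c R θ) - f z := by
  have hderiv (r : ℝ) (hr : r ∈ uIcc (0 : ℝ) 1) :
      HasDerivAt (fun r : ℝ => f (z + r * (circleMap c R θ - z)))
        (fderiv ℝ f (z + r * (circleMap c R θ - z)) (circleMap c R θ - z)) r := by
    rw [uIcc_of_le zero_le_one] at hr
    have h1 := ((hf.differentiableOn one_ne_zero).differentiableAt
      (hU.mem_nhds (hUc (segment_mem_ball hz hr θ)))).hasFDerivAt
    have h2 : HasDerivAt (fun r : ℝ => z + r * (circleMap c R θ - z)) (circleMap c R θ - z) r := by
      simpa using ((hasDerivAt_id r).ofReal_comp.mul_const (circleMap c R θ - z)).const_add z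
    exact h1.comp_hasDerivAt r h2
  rw [intervalIntegral.integral_eq_sub_of_hasDerivAt hderiv]
  · simp
  · refine ContinuousOn.intervalIntegrable ?_
    rw [uIcc_of_le zero_le_one]
    have h := (continuousOn_fderiv_segment hU hUc hf hz).comp
      (f := fun r : ℝ => (r, θ)) (s := Icc 0 1) (by fun_prop) (fun r hr => ⟨hr, mem_univ _⟩)
    exact h.clm_apply continuousOn_const

/-- The area integral of `∂̄f / (w - z)` as a contour integral without singularity. -/
theorem setIntegral_dbar_eq_circleIntegral {z c : ℂ} {R : ℝ} {f : ℂ → ℂ} {U : Set ℂ}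
    (hU : IsOpen U) (hUc : closedBall c R ⊆ U) (hf : ContDiffOn ℝ 1 f U) (hz : z ∈ ball c R) :
    2 * Complex.I * ∫ w in ball c R,
      ((1 / 2) * (fderiv ℝ f w 1 + Complex.I * fderiv ℝ f w Complex.I)) / (w - z) =
    ∮ w in C(c, R), (f w - f z) / (w - z) := by
  have hπ : -Real.pi ≤ Real.pi := by linarith [Real.pi_pos]
  have hD := continuousOn_fderiv_segment hU hUc hf hz
  have hc := continuous_circleMap c R
  have hc0 := continuous_circleMap 0 R
  have hq : Continuous fun θ => circleMap 0 R θ * Complex.I / (circleMap c R θ - z) :=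
    (hc0.mul_const _).div (hc.sub continuous_const) (circleMap_sub_ne_zero hz)
  have hsub : Ioo (0 : ℝ) 1 ×ˢ Ioo (-Real.pi) Real.pi ⊆ Icc (0 : ℝ) 1 ×ˢ Icc (-Real.pi) Real.pi :=
    prod_mono Ioo_subset_Icc_self Ioo_subset_Icc_self
  have hint {F : ℝ × ℝ → ℂ} (hF : ContinuousOn F (Icc 0 1 ×ˢ univ)) :
      IntegrableOn F (Ioo (0 : ℝ) 1 ×ˢ Ioo (-Real.pi) Real.pi) :=
    ((hF.mono (prod_mono subset_rfl (subset_univ _))).integrableOn_compact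
      (isCompact_Icc.prod isCompact_Icc)).mono_set hsub
  have hA : IntegrableOn (fun p : ℝ × ℝ => fderiv ℝ f (z + p.1 * (circleMap c R p.2 - z))
      (circleMap c R p.2 - z) * (circleMap 0 R p.2 * Complex.I / (circleMap c R p.2 - z)))
      (Ioo (0 : ℝ) 1 ×ˢ Ioo (-Real.pi) Real.pi) :=
    hint ((hD.clm_apply (by fun_prop)).mul (hq.comp continuous_snd).continuousOn)
  have hB : IntegrableOn (fun p : ℝ × ℝ => fderiv ℝ f (z + p.1 * (circleMap c R p.2 - z))
      (circleMap 0 R p.2 * Complex.I)) (Ioo (0 : ℝ) 1 ×ˢ Ioo (-Real.pi) Real.pi) :=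
    hint (hD.clm_apply (by fun_prop))
  rw [setIntegral_ball_eq_setIntegral_star hz, ← integral_const_mul,
    setIntegral_congr_fun (measurableSet_Ioo.prod measurableSet_Ioo)
      (fun p hp => dbar_mul_starDensity _ hz hp.1.1.ne' p.2),
    integral_sub hA hB]
  have hBzero : ∫ p in Ioo (0 : ℝ) 1 ×ˢ Ioo (-Real.pi) Real.pi,
      fderiv ℝ f (z + p.1 * (circleMap c R p.2 - z)) (circleMap 0 R p.2 * Complex.I) = 0 := by
    rw [Measure.volume_eq_prod, setIntegral_prod _ hB]
    refine setIntegral_eq_zero_of_forall_eq_zero fun r hr => ?_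
    rw [← integral_Ioc_eq_integral_Ioo, ← intervalIntegral.integral_of_le hπ]
    exact integral_fderiv_tangential hU hUc hf hz ⟨hr.1, hr.2.le⟩
  have hperiodic : Function.Periodic
      (fun θ => deriv (circleMap c R) θ • ((f (circleMap c R θ) - f z) / (circleMap c R θ - z)))
      (2 * Real.pi) := by
    intro θ
    simp only [deriv_circleMap, periodic_circleMap _ R θ]
  have hshift := hperiodic.intervalIntegral_add_eq 0 (-Real.pi)
  rw [zero_add, show -Real.pi + 2 * Real.pi = Real.pi by ring] at hshift
  rw [hBzero, sub_zero, circleIntegral, hshift, Measure.volume_eq_prod, ← Measure.prod_restrict,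
    integral_prod_symm _ (by rwa [Measure.prod_restrict]), intervalIntegral.integral_of_le hπ,
    integral_Ioc_eq_integral_Ioo]
  congr 1
  ext1 θ
  dsimp only
  rw [integral_mul_const, ← integral_Ioc_eq_integral_Ioo,
    ← intervalIntegral.integral_of_le zero_le_one, integral_fderiv_radial hU hUc hf hz,
    deriv_circleMap, smul_eq_mul]
  ring

end

/-- Cauchy–Pompeiu formula: if `f : ℂ → ℂ` is continuously differentiable (over `ℝ`) on an
open neighborhood of the closed disc `D̄_R(c)`, then for every `z` in the open disc `D_R(c)`,
`f(z) = (1/(2πi)) ∮_{|w−c|=R} f(w)/(w−z) dw − (1/π) ∫_{D_R(c)} (∂̄f)(w)/(w−z) dA(w)`,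
where `∂̄f = ½(∂_x f + i ∂_y f)`. -/
theorem cauchy_pompeiu (R : ℝ) (hR : 0 < R) (c : ℂ) (f : ℂ → ℂ) (U : Set ℂ)
    (hU : IsOpen U) (hUc : Metric.closedBall c R ⊆ U) (hf : ContDiffOn ℝ 1 f U)
    (z : ℂ) (hz : z ∈ Metric.ball c R) :
    f z = (1 / (2 * Real.pi * Complex.I)) * (∮ w in C(c, R), f w / (w - z))
      - (1 / (Real.pi : ℂ)) * ∫ w in Metric.ball c R,
          ((1 / 2) * (fderiv ℝ f w 1 + Complex.I * fderiv ℝ f w Complex.I)) / (w - z) := by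
  have hc : ContinuousOn f (Metric.sphere c R) :=
    hf.continuousOn.mono (Metric.sphere_subset_closedBall.trans hUc)
  have hinv : ContinuousOn (fun w => (w - z)⁻¹) (Metric.sphere c R) := by
    refine ContinuousOn.inv₀ (by fun_prop) fun w hw => sub_ne_zero.2 ?_
    rintro rfl
    exact (Metric.mem_ball.1 hz).ne (Metric.mem_sphere.1 hw)
  have hsplit : (∮ w in C(c, R), (f w - f z) / (w - z)) =
      (∮ w in C(c, R), f w / (w - z)) - f z * (2 * Real.pi * Complex.I) := by
    simp only [div_eq_mul_inv, sub_mul]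
    have h1 : CircleIntegrable (fun w => f w * (w - z)⁻¹) c R :=
      (hc.mul hinv).circleIntegrable hR.le
    have h2 : CircleIntegrable (fun w => f z * (w - z)⁻¹) c R :=
      (continuousOn_const.mul hinv).circleIntegrable hR.le
    rw [circleIntegral.integral_sub h1 h2, circleIntegral.integral_const_mul,
      circleIntegral.integral_sub_inv_of_mem_ball hz]
  have h := (setIntegral_dbar_eq_circleIntegral hU hUc hf hz).trans hsplit
  have hπ : (Real.pi : ℂ) ≠ 0 := Complex.ofReal_ne_zero.2 Real.pi_ne_zero
  have hI := Complex.I_ne_zero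
  generalize (∮ w in C(c, R), f w / (w - z)) = A at h ⊢
  generalize (∫ w in Metric.ball c R, ((1 / 2) * (fderiv ℝ f w 1 +
    Complex.I * fderiv ℝ f w Complex.I)) / (w - z)) = B at h ⊢
  field_simp
  linear_combination h
end

section
/- Let R > 0, 1 < p < ∞, M ≥ 0. Let (h_k)_{k∈ℕ} be a sequence of measurable functions on the ball B_R(0) ⊂ ℝ² with ‖h_k‖_{L^p(B_R(0))} ≤ M for all k, let h be integrable on B_R(0), and let α ∈ ℝ. Suppose that for every continuous function φ : ℝ² → ℝ with compact support contained in B_R(0), one has ∫_{B_R(0)} h_k φ dx → ∫_{B_R(0)} h φ dx + α φ(0) as k → ∞. Then α = 0. (A sequence bounded in L^p with p > 1 cannot produce an atomic part, i.e. a Dirac mass, in its weak-* limit.) -/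
open MeasureTheory Filter

/-- The radial hat function `x ↦ max 0 (1 - ‖x‖ / r)` of height `1` and radius `r`. -/
noncomputable def hat {E : Type*} [Norm E] (r : ℝ) (x : E) : ℝ := max 0 (1 - ‖x‖ / r)

section Hat

variable {E : Type*} [NormedAddCommGroup E]

theorem continuous_hat (r : ℝ) : Continuous (hat r : E → ℝ) := by
  unfold hat
  fun_prop

theorem hat_zero (r : ℝ) : hat r (0 : E) = 1 := by
  simp [hat]

theorem hat_nonneg (r : ℝ) (x : E) : 0 ≤ hat r x := le_max_left _ _

theorem hat_le_one {r : ℝ} (hr : 0 ≤ r) (x : E) : hat r x ≤ 1 := by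
  have : 0 ≤ ‖x‖ / r := by positivity
  exact max_le zero_le_one (by linarith)

theorem hat_eq_zero {r : ℝ} (hr : 0 < r) {x : E} (hx : r ≤ ‖x‖) : hat r x = 0 := by
  have : 1 ≤ ‖x‖ / r := (one_le_div hr).2 hx
  exact max_eq_left (by linarith)

theorem tsupport_hat_subset {r : ℝ} (hr : 0 < r) :
    tsupport (hat r : E → ℝ) ⊆ Metric.closedBall 0 r := by
  refine closure_minimal (fun x hx => ?_) Metric.isClosed_closedBall
  rw [mem_closedBall_zero_iff]
  by_contra! h
  exact hx (hat_eq_zero hr h.le)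

theorem hasCompactSupport_hat [ProperSpace E] {r : ℝ} (hr : 0 < r) :
    HasCompactSupport (hat r : E → ℝ) :=
  (isCompact_closedBall (0 : E) r).of_isClosed_subset (isClosed_tsupport _)
    (tsupport_hat_subset hr)

theorem enorm_hat_le_one {r : ℝ} (hr : 0 ≤ r) (x : E) : ‖hat r x‖ₑ ≤ 1 := by
  rw [Real.enorm_of_nonneg (hat_nonneg r x)]
  exact ENNReal.ofReal_le_one.2 (hat_le_one hr x)

theorem tendsto_hat_of_ne_zero {r : ℕ → ℝ} (hr : ∀ n, 0 < r n)
    (hlim : Tendsto r atTop (nhds 0)) {x : E} (hx : x ≠ 0) :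
    Tendsto (fun n => hat (r n) x) atTop (nhds 0) := by
  refine tendsto_const_nhds.congr' ?_
  filter_upwards [hlim.eventually_lt_const (norm_pos_iff.2 hx)] with n hn
  exact (hat_eq_zero (hr n) hn.le).symm

variable [MeasurableSpace E] [BorelSpace E] {μ : Measure E} [NullSingletonClass μ]

theorem tendsto_integral_mul_hat {r : ℕ → ℝ} (hr : ∀ n, 0 < r n)
    (hlim : Tendsto r atTop (nhds 0)) {f : E → ℝ} (hf : Integrable f μ) :
    Tendsto (fun n => ∫ x, f x * hat (r n) x ∂μ) atTop (nhds 0) := by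
  rw [← integral_zero E ℝ (μ := μ)]
  refine tendsto_integral_of_dominated_convergence (fun x => ‖f x‖)
    (fun n => hf.aestronglyMeasurable.mul
      (continuous_hat (r n)).measurable.aestronglyMeasurable) hf.norm
    (fun n => Eventually.of_forall fun x => ?_) ?_
  · rw [norm_mul, Real.norm_of_nonneg (hat_nonneg _ _)]
    exact mul_le_of_le_one_right (norm_nonneg _) (hat_le_one (hr n).le x)
  · filter_upwards [Measure.ae_ne μ 0] with x hx
    simpa using (tendsto_hat_of_ne_zero hr hlim hx).const_mul (f x)

theorem tendsto_lintegral_enorm_hat_rpow [IsFiniteMeasure μ] {r : ℕ → ℝ} (hr : ∀ n, 0 < r n)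
    (hlim : Tendsto r atTop (nhds 0)) {q : ℝ} (hq : 0 < q) :
    Tendsto (fun n => (∫⁻ x, ‖hat (r n) x‖ₑ ^ q ∂μ) ^ (1 / q)) atTop (nhds 0) := by
  have key : Tendsto (fun n => ∫⁻ x, ‖hat (r n) x‖ₑ ^ q ∂μ) atTop (nhds 0) := by
    rw [← lintegral_zero (μ := μ)]
    refine tendsto_lintegral_of_dominated_convergence 1
      (fun n => (continuous_hat (r n)).measurable.enorm.pow_const q)
      (fun n => Eventually.of_forall fun x =>
        ENNReal.rpow_le_one (enorm_hat_le_one (hr n).le x) hq.le) (by simp) ?_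
    filter_upwards [Measure.ae_ne μ 0] with x hx
    have := (tendsto_hat_of_ne_zero hr hlim hx).enorm.ennrpow_const q
    simpa [ENNReal.zero_rpow_of_pos hq] using this
  have := key.ennrpow_const (1 / q)
  rwa [ENNReal.zero_rpow_of_pos (by positivity)] at this

end Hat

/-- The Hölder inequality for the Bochner integral of a product, with extended-real right-hand
side. -/
theorem enorm_integral_mul_le_lintegral_rpow {X : Type*} [MeasurableSpace X] {μ : Measure X}
    {p q : ℝ} (hpq : p.HolderConjugate q) {f g : X → ℝ} (hf : AEMeasurable f μ)
    (hg : AEMeasurable g μ) :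
    ‖∫ x, f x * g x ∂μ‖ₑ ≤
      (∫⁻ x, ‖f x‖ₑ ^ p ∂μ) ^ (1 / p) * (∫⁻ x, ‖g x‖ₑ ^ q ∂μ) ^ (1 / q) := by
  refine (enorm_integral_le_lintegral_enorm _).trans ?_
  simp_rw [enorm_mul]
  exact ENNReal.lintegral_mul_le_Lp_mul_Lq μ hpq hf.enorm hg.enorm

/-- A sequence bounded in `L^p`, `p > 1`, cannot produce a Dirac mass in its weak-* limit:
if `‖h_k‖_{L^p(B_R(0))} ≤ M` and `∫ h_k φ → ∫ h φ + α φ(0)` for all continuous `φ`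
compactly supported in `B_R(0)`, then `α = 0`. -/
theorem no_atoms_in_Lp_weak_limit (R p M : ℝ) (hR : 0 < R) (hp : 1 < p) (hM : 0 ≤ M)
    (h : ℕ → EuclideanSpace ℝ (Fin 2) → ℝ) (h₀ : EuclideanSpace ℝ (Fin 2) → ℝ) (α : ℝ)
    (hmeas : ∀ k, Measurable (h k))
    (hbound : ∀ k, (∫⁻ x in Metric.ball (0 : EuclideanSpace ℝ (Fin 2)) R,
        ENNReal.ofReal |h k x| ^ p) ^ (1 / p) ≤ ENNReal.ofReal M)
    (hint : IntegrableOn h₀ (Metric.ball (0 : EuclideanSpace ℝ (Fin 2)) R))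
    (hconv : ∀ φ : EuclideanSpace ℝ (Fin 2) → ℝ, Continuous φ → HasCompactSupport φ →
      tsupport φ ⊆ Metric.ball (0 : EuclideanSpace ℝ (Fin 2)) R →
      Tendsto (fun k => ∫ x in Metric.ball (0 : EuclideanSpace ℝ (Fin 2)) R, h k x * φ x)
        atTop
        (nhds ((∫ x in Metric.ball (0 : EuclideanSpace ℝ (Fin 2)) R, h₀ x * φ x)
          + α * φ 0))) :
    α = 0 := by
  have hpq : p.HolderConjugate p.conjExponent := .conjExponent hp
  set q := p.conjExponent
  set B := Metric.ball (0 : EuclideanSpace ℝ (Fin 2)) R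
  have : IsFiniteMeasure (volume.restrict B) := isFiniteMeasure_restrict.2 measure_ball_lt_top.ne
  obtain ⟨r, -, hr, hlim⟩ := exists_seq_strictAnti_tendsto' hR
  have hr0 : ∀ n, 0 < r n := fun n => (hr n).1
  have hle : ∀ n, ‖(∫ x in B, h₀ x * hat (r n) x) + α‖ₑ ≤
      ENNReal.ofReal M * (∫⁻ x in B, ‖hat (r n) x‖ₑ ^ q) ^ (1 / q) := by
    intro n
    have hT := hconv (hat (r n)) (continuous_hat _) (hasCompactSupport_hat (hr0 n))
      ((tsupport_hat_subset (hr0 n)).trans (Metric.closedBall_subset_ball (hr n).2))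
    rw [hat_zero, mul_one] at hT
    refine le_of_tendsto' hT.enorm fun k => ?_
    refine (enorm_integral_mul_le_lintegral_rpow hpq (hmeas k).aemeasurable
      (continuous_hat _).measurable.aemeasurable).trans ?_
    gcongr
    simpa only [Real.enorm_eq_ofReal_abs] using hbound k
  have hL := ((tendsto_integral_mul_hat hr0 hlim hint).add_const α).enorm
  have hU := ENNReal.Tendsto.const_mul (a := ENNReal.ofReal M)
    (tendsto_lintegral_enorm_hat_rpow (μ := volume.restrict B) hr0 hlim hpq.symm.pos)
    (Or.inr ENNReal.ofReal_ne_top)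
  simpa using le_of_tendsto_of_tendsto' hL hU hle
end

section
/- (Morrey embedding H² ↪ C^{1/2} in dimension two) There exists a constant C > 0 such that for every function f : ℝ² → ℝ that is smooth on an open neighborhood of the closed unit ball B̄₁(0), and for all x, y in the closed ball B̄_{1/2}(0), one has |f(x) − f(y)| ≤ C (‖f‖_{L²(B₁(0))} + ‖∇f‖_{L²(B₁(0))} + ‖∇²f‖_{L²(B₁(0))}) |x − y|^{1/2}, where ∇²f denotes the Hessian matrix of f and its L² norm is taken with the Frobenius norm. -/
open MeasureTheory

theorem sq_intervalIntegral_le {u : ℝ → ℝ} {a b : ℝ} (hab : a ≤ b)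
    (hu : ContinuousOn u (Set.Icc a b)) :
    (∫ s in a..b, u s) ^ 2 ≤ (b - a) * ∫ s in a..b, u s ^ 2 := by
  rcases hab.eq_or_lt with rfl | hlt
  · simp
  have hi : IntervalIntegrable u volume a b := hu.intervalIntegrable_of_Icc hab
  have hi2 : IntervalIntegrable (fun s => u s ^ 2) volume a b :=
    (hu.pow 2).intervalIntegrable_of_Icc hab
  set A := ∫ s in a..b, u s
  have h0 : 0 ≤ ∫ s in a..b, ((b - a) * u s - A) ^ 2 :=
    intervalIntegral.integral_nonneg hab fun s _ => sq_nonneg _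
  have h1 : ∫ s in a..b, ((b - a) * u s - A) ^ 2
      = (b - a) ^ 2 * (∫ s in a..b, u s ^ 2) - 2 * (b - a) * A * A + (b - a) * A ^ 2 := by
    have : ∀ s, ((b - a) * u s - A) ^ 2
        = (b - a) ^ 2 * u s ^ 2 - 2 * (b - a) * A * u s + A ^ 2 := fun s => by ring
    simp_rw [this]
    rw [intervalIntegral.integral_add ((hi2.const_mul _).sub (hi.const_mul _)) (by simp),
      intervalIntegral.integral_sub (hi2.const_mul _) (hi.const_mul _)]
    simp [A]
  have hpos : 0 < b - a := sub_pos.2 hlt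
  rw [h1] at h0
  refine le_of_mul_le_mul_left ?_ hpos
  nlinarith

theorem sq_sub_le_mul_setIntegral_deriv_sq {u w : ℝ → ℝ} {c d a b : ℝ}
    (hu : ∀ s ∈ Set.Icc c d, HasDerivAt u (w s) s) (hw : ContinuousOn w (Set.Icc c d))
    (ha : a ∈ Set.Icc c d) (hb : b ∈ Set.Icc c d) :
    (u a - u b) ^ 2 ≤ |a - b| * ∫ s in Set.Icc c d, w s ^ 2 := by
  wlog hab : a ≤ b generalizing a b
  · rw [abs_sub_comm, ← neg_sub, neg_sq]
    exact this hb ha (le_of_not_ge hab)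
  have hsub : Set.Icc a b ⊆ Set.Icc c d := Set.Icc_subset_Icc ha.1 hb.2
  have hftc : ∫ s in a..b, w s = u b - u a :=
    intervalIntegral.integral_eq_sub_of_hasDerivAt
      (fun s hs => hu s (hsub (by rwa [Set.uIcc_of_le hab] at hs)))
      ((hw.mono hsub).intervalIntegrable_of_Icc hab)
  have h := sq_intervalIntegral_le hab (hw.mono hsub)
  rw [hftc] at h
  rw [abs_sub_comm, abs_of_nonneg (sub_nonneg.2 hab), ← neg_sub, neg_sq]
  refine h.trans (mul_le_mul_of_nonneg_left ?_ (sub_nonneg.2 hab))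
  rw [intervalIntegral.integral_of_le hab]
  exact setIntegral_mono_set ((hw.pow 2).integrableOn_Icc)
    (Filter.Eventually.of_forall fun s => sq_nonneg _)
    (Set.Ioc_subset_Icc_self.trans hsub).eventuallyLE

theorem sq_le_setIntegral_sq_add_deriv_sq {u w : ℝ → ℝ} {c t : ℝ}
    (hu : ∀ s ∈ Set.Icc c (c + 1), HasDerivAt u (w s) s)
    (hw : ContinuousOn w (Set.Icc c (c + 1))) (ht : t ∈ Set.Icc c (c + 1)) :
    u t ^ 2 ≤ ∫ s in Set.Icc c (c + 1), 2 * (u s ^ 2 + w s ^ 2) := by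
  have huc : ContinuousOn u (Set.Icc c (c + 1)) :=
    fun s hs => (hu s hs).continuousAt.continuousWithinAt
  have hi : IntegrableOn (fun s => 2 * u s ^ 2) (Set.Icc c (c + 1)) :=
    (continuousOn_const.mul (huc.pow 2)).integrableOn_Icc
  have hj : IntegrableOn (fun s => 2 * w s ^ 2) (Set.Icc c (c + 1)) :=
    (continuousOn_const.mul (hw.pow 2)).integrableOn_Icc
  have hk : ∀ r : ℝ, IntegrableOn (fun _ => r) (Set.Icc c (c + 1)) := fun r =>
    continuousOn_const.integrableOn_Icc
  have hW : 0 ≤ ∫ s in Set.Icc c (c + 1), w s ^ 2 := integral_nonneg fun s => sq_nonneg _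
  have hconst : ∀ r : ℝ, ∫ _ in Set.Icc c (c + 1), r = r := fun r => by simp
  have hpt : ∀ s ∈ Set.Icc c (c + 1),
      u t ^ 2 ≤ 2 * u s ^ 2 + 2 * ∫ s in Set.Icc c (c + 1), w s ^ 2 := fun s hs => by
    have h := sq_sub_le_mul_setIntegral_deriv_sq hu hw ht hs
    have hle : |t - s| ≤ 1 := abs_le.2 ⟨by linarith [ht.1, hs.2], by linarith [ht.2, hs.1]⟩
    nlinarith [mul_le_mul_of_nonneg_right hle hW, sq_nonneg (u t - 2 * u s)]
  calc u t ^ 2 = ∫ _ in Set.Icc c (c + 1), u t ^ 2 := (hconst _).symm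
    _ ≤ ∫ s in Set.Icc c (c + 1), (2 * u s ^ 2 + 2 * ∫ s in Set.Icc c (c + 1), w s ^ 2) :=
      setIntegral_mono_on (hk _) (hi.add (hk _)) measurableSet_Icc hpt
    _ = _ := by
      rw [integral_add hi (hk _), hconst, ← integral_const_mul, ← integral_add hi hj]
      simp_rw [mul_add]

theorem sq_sub_le_mul_setIntegral_prod {φ d m : ℝ → ℝ → ℝ} {c a b t : ℝ}
    (hφ : ∀ s ∈ Set.Icc c (c + 1), ∀ t ∈ Set.Icc c (c + 1),
      HasDerivAt (fun s => φ s t) (d s t) s)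
    (hd : ∀ s ∈ Set.Icc c (c + 1), ∀ t ∈ Set.Icc c (c + 1), HasDerivAt (d s) (m s t) t)
    (hdc : ContinuousOn (Function.uncurry d) (Set.Icc c (c + 1) ×ˢ Set.Icc c (c + 1)))
    (hmc : ContinuousOn (Function.uncurry m) (Set.Icc c (c + 1) ×ˢ Set.Icc c (c + 1)))
    (ha : a ∈ Set.Icc c (c + 1)) (hb : b ∈ Set.Icc c (c + 1)) (ht : t ∈ Set.Icc c (c + 1)) :
    (φ a t - φ b t) ^ 2 ≤ |a - b| *
      ∫ p in Set.Icc c (c + 1) ×ˢ Set.Icc c (c + 1), 2 * (d p.1 p.2 ^ 2 + m p.1 p.2 ^ 2) := by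
  have hdt : ContinuousOn (fun s => d s t) (Set.Icc c (c + 1)) :=
    hdc.comp (f := fun s => (s, t)) (by fun_prop) fun s hs => ⟨hs, ht⟩
  have hms : ∀ s ∈ Set.Icc c (c + 1), ContinuousOn (m s) (Set.Icc c (c + 1)) := fun s hs =>
    hmc.comp (f := fun t => (s, t)) (by fun_prop) fun t ht => ⟨hs, ht⟩
  have hint : IntegrableOn (fun p : ℝ × ℝ => 2 * (d p.1 p.2 ^ 2 + m p.1 p.2 ^ 2))
      (Set.Icc c (c + 1) ×ˢ Set.Icc c (c + 1)) (volume.prod volume) :=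
    (continuousOn_const.mul ((hdc.pow 2).add (hmc.pow 2))).integrableOn_compact
      (isCompact_Icc.prod isCompact_Icc)
  refine (sq_sub_le_mul_setIntegral_deriv_sq (fun s hs => hφ s hs t ht) hdt ha hb).trans
    (mul_le_mul_of_nonneg_left ?_ (abs_nonneg _))
  rw [Measure.volume_eq_prod, setIntegral_prod _ hint]
  refine setIntegral_mono_on (hdt.pow 2).integrableOn_Icc ?_ measurableSet_Icc
    fun s hs => sq_le_setIntegral_sq_add_deriv_sq (hd s hs) (hms s hs) ht
  rw [IntegrableOn, ← Measure.prod_restrict] at hint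
  exact hint.integral_prod_left

theorem measurePreserving_toLp_finTwoArrow_symm :
    MeasurePreserving (fun p : ℝ × ℝ => (!₂[p.1, p.2] : EuclideanSpace ℝ (Fin 2))) :=
  (PiLp.volume_preserving_toLp (Fin 2)).comp (volume_preserving_finTwoArrow ℝ).symm

theorem measurableEmbedding_toLp_finTwoArrow_symm :
    MeasurableEmbedding (fun p : ℝ × ℝ => (!₂[p.1, p.2] : EuclideanSpace ℝ (Fin 2))) :=
  (MeasurableEquiv.toLp 2 (Fin 2 → ℝ)).measurableEmbedding.comp
    (MeasurableEquiv.finTwoArrow (α := ℝ)).symm.measurableEmbedding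

theorem smul_single_zero_add_smul_single_one (s t : ℝ) :
    s • EuclideanSpace.single (0 : Fin 2) (1 : ℝ) + t • EuclideanSpace.single 1 1 = !₂[s, t] := by
  ext k
  fin_cases k <;> simp

theorem measurePreserving_smul_single_add_smul_single {i j : Fin 2} (hij : i ≠ j) :
    MeasurePreserving (fun p : ℝ × ℝ =>
      p.1 • EuclideanSpace.single i (1 : ℝ) + p.2 • EuclideanSpace.single j 1) ∧
    MeasurableEmbedding (fun p : ℝ × ℝ =>
      p.1 • EuclideanSpace.single i (1 : ℝ) + p.2 • EuclideanSpace.single j 1) := by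
  have key : i = 0 ∧ j = 1 ∨ i = 1 ∧ j = 0 := by omega
  rcases key with ⟨rfl, rfl⟩ | ⟨rfl, rfl⟩
  · simp_rw [smul_single_zero_add_smul_single_one]
    exact ⟨measurePreserving_toLp_finTwoArrow_symm, measurableEmbedding_toLp_finTwoArrow_symm⟩
  · simp_rw [add_comm (_ • EuclideanSpace.single (1 : Fin 2) (1 : ℝ)),
      smul_single_zero_add_smul_single_one]
    exact ⟨measurePreserving_toLp_finTwoArrow_symm.comp Measure.measurePreserving_swap,
      measurableEmbedding_toLp_finTwoArrow_symm.comp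
        MeasurableEquiv.prodComm.measurableEmbedding⟩

theorem smul_single_add_smul_single_mem_ball {i j : Fin 2} (hij : i ≠ j) {s t : ℝ}
    (hs : s ∈ Set.Icc (-1 / 2 : ℝ) (-1 / 2 + 1)) (ht : t ∈ Set.Icc (-1 / 2 : ℝ) (-1 / 2 + 1)) :
    s • EuclideanSpace.single i (1 : ℝ) + t • EuclideanSpace.single j 1
      ∈ Metric.ball (0 : EuclideanSpace ℝ (Fin 2)) 1 := by
  have key : i = 0 ∧ j = 1 ∨ i = 1 ∧ j = 0 := by omega
  rw [mem_ball_zero_iff, ← sq_lt_one_iff₀ (norm_nonneg _), EuclideanSpace.real_norm_sq_eq]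
  rcases key with ⟨rfl, rfl⟩ | ⟨rfl, rfl⟩ <;> simp <;> nlinarith [hs.1, hs.2, ht.1, ht.2]

theorem sq_sub_le_mul_setIntegral_ball {f : EuclideanSpace ℝ (Fin 2) → ℝ}
    {U : Set (EuclideanSpace ℝ (Fin 2))} (hU : IsOpen U)
    (hBU : Metric.closedBall (0 : EuclideanSpace ℝ (Fin 2)) 1 ⊆ U) (hf : ContDiffOn ℝ 2 f U)
    {i j : Fin 2} (hij : i ≠ j) {a b t : ℝ}
    (ha : a ∈ Set.Icc (-1 / 2 : ℝ) (-1 / 2 + 1)) (hb : b ∈ Set.Icc (-1 / 2 : ℝ) (-1 / 2 + 1))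
    (ht : t ∈ Set.Icc (-1 / 2 : ℝ) (-1 / 2 + 1)) :
    (f (a • EuclideanSpace.single i (1 : ℝ) + t • EuclideanSpace.single j 1)
      - f (b • EuclideanSpace.single i (1 : ℝ) + t • EuclideanSpace.single j 1)) ^ 2
      ≤ |a - b| * (2 * ((∫ z in Metric.ball (0 : EuclideanSpace ℝ (Fin 2)) 1,
              ∑ i : Fin 2, fderiv ℝ f z (EuclideanSpace.single i 1) ^ 2)
          + (∫ z in Metric.ball (0 : EuclideanSpace ℝ (Fin 2)) 1,
              ∑ i : Fin 2, ∑ j : Fin 2,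
                (fderiv ℝ (fun w => fderiv ℝ f w (EuclideanSpace.single j 1)) z
                  (EuclideanSpace.single i 1)) ^ 2))) := by
  set D : Fin 2 → EuclideanSpace ℝ (Fin 2) → ℝ :=
    fun k w => fderiv ℝ f w (EuclideanSpace.single k 1) with hD
  set H : Fin 2 → Fin 2 → EuclideanSpace ℝ (Fin 2) → ℝ :=
    fun k l w => fderiv ℝ (D l) w (EuclideanSpace.single k 1) with hH
  have hDd : ∀ k, ContDiffOn ℝ 1 (D k) U := fun k =>
    (hf.fderiv_of_isOpen hU (by norm_num)).clm_apply contDiffOn_const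
  have hHc : ∀ k l, ContinuousOn (H k l) U := fun k l =>
    ((hDd l).continuousOn_fderiv_of_isOpen hU le_rfl).clm_apply continuousOn_const
  have hint : ∀ {g : EuclideanSpace ℝ (Fin 2) → ℝ}, ContinuousOn g U →
      IntegrableOn g (Metric.ball (0 : EuclideanSpace ℝ (Fin 2)) 1) := fun hg =>
    ((hg.mono hBU).integrableOn_compact (isCompact_closedBall _ _)).mono_set
      Metric.ball_subset_closedBall
  have hmem : ∀ s ∈ Set.Icc (-1 / 2 : ℝ) (-1 / 2 + 1), ∀ t ∈ Set.Icc (-1 / 2 : ℝ) (-1 / 2 + 1),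
      s • EuclideanSpace.single i (1 : ℝ) + t • EuclideanSpace.single j 1 ∈
        Metric.ball (0 : EuclideanSpace ℝ (Fin 2)) 1 := fun s hs t ht =>
    smul_single_add_smul_single_mem_ball hij hs ht
  have hmemU : ∀ s ∈ Set.Icc (-1 / 2 : ℝ) (-1 / 2 + 1), ∀ t ∈ Set.Icc (-1 / 2 : ℝ) (-1 / 2 + 1),
      s • EuclideanSpace.single i (1 : ℝ) + t • EuclideanSpace.single j 1 ∈ U := fun s hs t ht =>
    hBU (Metric.ball_subset_closedBall (hmem s hs t ht))
  have hcomp : ∀ {g : EuclideanSpace ℝ (Fin 2) → ℝ}, ContinuousOn g U →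
      ContinuousOn (fun p : ℝ × ℝ =>
        g (p.1 • EuclideanSpace.single i (1 : ℝ) + p.2 • EuclideanSpace.single j 1))
        (Set.Icc (-1 / 2 : ℝ) (-1 / 2 + 1) ×ˢ Set.Icc (-1 / 2 : ℝ) (-1 / 2 + 1)) := fun hg =>
    hg.comp (by fun_prop) fun p hp => hmemU p.1 hp.1 p.2 hp.2
  have hdiff : ∀ {g : EuclideanSpace ℝ (Fin 2) → ℝ}, ContDiffOn ℝ 1 g U → ∀ z ∈ U,
      HasFDerivAt g (fderiv ℝ g z) z := fun hg z hz =>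
    ((hg.differentiableOn one_ne_zero).differentiableAt (hU.mem_nhds hz)).hasFDerivAt
  have hslice := sq_sub_le_mul_setIntegral_prod
    (φ := fun s t => f (s • EuclideanSpace.single i (1 : ℝ) + t • EuclideanSpace.single j 1))
    (d := fun s t => D i (s • EuclideanSpace.single i (1 : ℝ) + t • EuclideanSpace.single j 1))
    (m := fun s t => H j i (s • EuclideanSpace.single i (1 : ℝ) + t • EuclideanSpace.single j 1))
    (fun s hs t ht => by
      have h1 : HasDerivAt (fun s : ℝ => s • EuclideanSpace.single i (1 : ℝ)
          + t • EuclideanSpace.single j 1) (EuclideanSpace.single i (1 : ℝ)) s := by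
        simpa using ((hasDerivAt_id s).smul_const (EuclideanSpace.single i (1 : ℝ))).add_const
          (t • EuclideanSpace.single j (1 : ℝ))
      exact (hdiff (hf.of_le one_le_two) _ (hmemU s hs t ht)).comp_hasDerivAt s h1)
    (fun s hs t ht => by
      have h1 : HasDerivAt (fun t : ℝ => s • EuclideanSpace.single i (1 : ℝ)
          + t • EuclideanSpace.single j 1) (EuclideanSpace.single j (1 : ℝ)) t := by
        simpa using ((hasDerivAt_id t).smul_const (EuclideanSpace.single j (1 : ℝ))).const_add
          (s • EuclideanSpace.single i (1 : ℝ))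
      exact (hdiff (hDd i) _ (hmemU s hs t ht)).comp_hasDerivAt t h1)
    (hcomp (hDd i).continuousOn) (hcomp (hHc j i)) ha hb ht
  refine hslice.trans (mul_le_mul_of_nonneg_left ?_ (abs_nonneg _))
  obtain ⟨hmp, hme⟩ := measurePreserving_smul_single_add_smul_single hij
  have hgrad : ContinuousOn (fun z => ∑ k, D k z ^ 2) U :=
    continuousOn_finsetSum _ fun k _ => (hDd k).continuousOn.pow 2
  have hhess : ContinuousOn (fun z => ∑ k, ∑ l, H k l z ^ 2) U :=
    continuousOn_finsetSum _ fun k _ => continuousOn_finsetSum _ fun l _ => (hHc k l).pow 2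
  have hc : ContinuousOn (fun z => 2 * (D i z ^ 2 + H j i z ^ 2)) U :=
    continuousOn_const.mul (((hDd i).continuousOn.pow 2).add ((hHc j i).pow 2))
  rw [← hmp.setIntegral_image_emb hme (fun z => 2 * (D i z ^ 2 + H j i z ^ 2)),
    ← integral_add (hint hgrad) (hint hhess), ← integral_const_mul]
  refine (setIntegral_mono_set (hint hc) (Filter.Eventually.of_forall fun z => by positivity)
    (LE.le.eventuallyLE ?_)).trans
    (setIntegral_mono_on (hint hc) (hint (continuousOn_const.mul (hgrad.add hhess)))
      measurableSet_ball fun z _ => ?_)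
  · rintro _ ⟨p, hp, rfl⟩
    exact hmem p.1 hp.1 p.2 hp.2
  · have h1 := Finset.single_le_sum (f := fun k => D k z ^ 2) (fun k _ => sq_nonneg _)
      (Finset.mem_univ i)
    have h2 := Finset.single_le_sum (f := fun l => H j l z ^ 2) (fun l _ => sq_nonneg _)
      (Finset.mem_univ i)
    have h3 := Finset.single_le_sum (f := fun k => ∑ l, H k l z ^ 2)
      (fun k _ => Finset.sum_nonneg fun l _ => sq_nonneg _) (Finset.mem_univ j)
    linarith

theorem abs_apply_le_norm (x : EuclideanSpace ℝ (Fin 2)) (k : Fin 2) : |x k| ≤ ‖x‖ := by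
  simpa using PiLp.norm_apply_le x k

theorem apply_mem_Icc_of_mem_closedBall {x : EuclideanSpace ℝ (Fin 2)}
    (hx : x ∈ Metric.closedBall (0 : EuclideanSpace ℝ (Fin 2)) (1 / 2)) (k : Fin 2) :
    x k ∈ Set.Icc (-1 / 2 : ℝ) (-1 / 2 + 1) := by
  have h := abs_le.1 ((abs_apply_le_norm x k).trans (mem_closedBall_zero_iff.1 hx))
  constructor <;> linarith [h.1, h.2]

/-- Morrey embedding `H² ↪ C^{1/2}` in dimension two: there is a constant `C > 0` such that
every function `f` smooth on a neighborhood of the closed unit ball of `ℝ²` satisfies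
`|f(x) − f(y)| ≤ C (‖f‖_{L²(B₁)} + ‖∇f‖_{L²(B₁)} + ‖∇²f‖_{L²(B₁)}) |x − y|^{1/2}` for all
`x, y` in the closed ball of radius `1/2`. -/
theorem morrey_H2_embedding_dim2 :
    ∃ C > 0, ∀ f : EuclideanSpace ℝ (Fin 2) → ℝ, ∀ U : Set (EuclideanSpace ℝ (Fin 2)),
      IsOpen U → Metric.closedBall (0 : EuclideanSpace ℝ (Fin 2)) 1 ⊆ U →
      ContDiffOn ℝ (⊤ : ℕ∞) f U →
      ∀ x ∈ Metric.closedBall (0 : EuclideanSpace ℝ (Fin 2)) (1 / 2),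
      ∀ y ∈ Metric.closedBall (0 : EuclideanSpace ℝ (Fin 2)) (1 / 2),
      |f x - f y| ≤ C *
        ((∫ z in Metric.ball (0 : EuclideanSpace ℝ (Fin 2)) 1, f z ^ 2) ^ (1 / 2 : ℝ)
          + (∫ z in Metric.ball (0 : EuclideanSpace ℝ (Fin 2)) 1,
              ∑ i : Fin 2, fderiv ℝ f z (EuclideanSpace.single i 1) ^ 2) ^ (1 / 2 : ℝ)
          + (∫ z in Metric.ball (0 : EuclideanSpace ℝ (Fin 2)) 1,
              ∑ i : Fin 2, ∑ j : Fin 2,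
                (fderiv ℝ (fun w => fderiv ℝ f w (EuclideanSpace.single j 1)) z
                  (EuclideanSpace.single i 1)) ^ 2) ^ (1 / 2 : ℝ))
        * Real.sqrt ‖x - y‖ := by
  refine ⟨2 * Real.sqrt 2, by positivity, fun f U hU hBU hf x hx y hy => ?_⟩
  have hf2 : ContDiffOn ℝ 2 f U := hf.of_le (WithTop.coe_le_coe.2 le_top)
  have h0 := sq_sub_le_mul_setIntegral_ball hU hBU hf2 (zero_ne_one (α := Fin 2))
    (apply_mem_Icc_of_mem_closedBall hx 0) (apply_mem_Icc_of_mem_closedBall hy 0)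
    (apply_mem_Icc_of_mem_closedBall hx 1)
  have h1 := sq_sub_le_mul_setIntegral_ball hU hBU hf2 (one_ne_zero (α := Fin 2))
    (apply_mem_Icc_of_mem_closedBall hx 1) (apply_mem_Icc_of_mem_closedBall hy 1)
    (apply_mem_Icc_of_mem_closedBall hy 0)
  rw [add_comm (x 1 • _), add_comm (y 1 • _)] at h1
  simp only [smul_single_zero_add_smul_single_one] at h0 h1
  have hcoord : ∀ z : EuclideanSpace ℝ (Fin 2), !₂[z 0, z 1] = z := fun z => by
    ext k
    fin_cases k <;> rfl
  rw [hcoord] at h0 h1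
  have hL : 0 ≤ ∫ z in Metric.ball (0 : EuclideanSpace ℝ (Fin 2)) 1, f z ^ 2 :=
    integral_nonneg fun z => sq_nonneg _
  have hG : 0 ≤ ∫ z in Metric.ball (0 : EuclideanSpace ℝ (Fin 2)) 1,
      ∑ i : Fin 2, fderiv ℝ f z (EuclideanSpace.single i 1) ^ 2 :=
    integral_nonneg fun z => Finset.sum_nonneg fun i _ => sq_nonneg _
  have hH : 0 ≤ ∫ z in Metric.ball (0 : EuclideanSpace ℝ (Fin 2)) 1,
      ∑ i : Fin 2, ∑ j : Fin 2,
        (fderiv ℝ (fun w => fderiv ℝ f w (EuclideanSpace.single j 1)) z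
          (EuclideanSpace.single i 1)) ^ 2 :=
    integral_nonneg fun z => Finset.sum_nonneg fun i _ => Finset.sum_nonneg fun j _ => sq_nonneg _
  simp only [← Real.sqrt_eq_rpow]
  set L := ∫ z in Metric.ball (0 : EuclideanSpace ℝ (Fin 2)) 1, f z ^ 2
  set G := ∫ z in Metric.ball (0 : EuclideanSpace ℝ (Fin 2)) 1,
    ∑ i : Fin 2, fderiv ℝ f z (EuclideanSpace.single i 1) ^ 2
  set H := ∫ z in Metric.ball (0 : EuclideanSpace ℝ (Fin 2)) 1,
    ∑ i : Fin 2, ∑ j : Fin 2,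
      (fderiv ℝ (fun w => fderiv ℝ f w (EuclideanSpace.single j 1)) z
        (EuclideanSpace.single i 1)) ^ 2
  have hsqrt : ∀ (k : Fin 2) (r : ℝ), r ^ 2 ≤ |x k - y k| * (2 * (G + H)) →
      |r| ≤ Real.sqrt 2 * (Real.sqrt L + Real.sqrt G + Real.sqrt H) * Real.sqrt ‖x - y‖ := by
    intro k r hr
    have hxy : |x k - y k| ≤ ‖x - y‖ := abs_apply_le_norm (x - y) k
    have hsum : Real.sqrt (G + H) ≤ Real.sqrt L + Real.sqrt G + Real.sqrt H := by
      refine Real.sqrt_le_iff.2 ⟨by positivity, ?_⟩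
      nlinarith [Real.sq_sqrt hG, Real.sq_sqrt hH, Real.sqrt_nonneg L, Real.sqrt_nonneg G,
        Real.sqrt_nonneg H, mul_nonneg (Real.sqrt_nonneg L) (Real.sqrt_nonneg G),
        mul_nonneg (Real.sqrt_nonneg L) (Real.sqrt_nonneg H),
        mul_nonneg (Real.sqrt_nonneg G) (Real.sqrt_nonneg H)]
    calc |r| ≤ Real.sqrt (‖x - y‖ * (2 * (G + H))) :=
          Real.abs_le_sqrt (hr.trans (by gcongr))
      _ = Real.sqrt 2 * Real.sqrt (G + H) * Real.sqrt ‖x - y‖ := by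
          rw [Real.sqrt_mul (norm_nonneg _), Real.sqrt_mul zero_le_two]
          ring
      _ ≤ _ := by gcongr
  calc |f x - f y| ≤ |f x - f !₂[y 0, x 1]| + |f !₂[y 0, x 1] - f y| := abs_sub_le _ _ _
    _ ≤ _ := add_le_add (hsqrt 0 _ h0) (hsqrt 1 _ h1)
    _ = _ := by ring
end
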